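/- arXiv:math/0505436 — 4 statements merged into one kernel-verified Lean document; each statement's English description precedes it below -/
import Mathlib

section
/- For all positive integers r and n, in the polynomial ring ℤ[q] one has ∑_{σ ∈ G_{r,n}} q^{exc^Abs(σ)} (−1)^{cyc(σ)} = −(q^r − 1)^{n−1} · [r]_q (equivalently, (q−1)·∑_{σ ∈ G_{r,n}} q^{exc^Abs(σ)}(−1)^{cyc(σ)} = −(q^r − 1)^n). -/
open Finset Polynomial

/-- Number of excedances of a permutation: #{i : τ(i) > i}. -/
def exc {n : ℕ} (τ : Equiv.Perm (Fin n)) : ℕ :=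
  (Finset.univ.filter fun i => i < τ i).card

/-- Number of cycles of a permutation, counting fixed points as cycles. -/
def cyc {n : ℕ} (τ : Equiv.Perm (Fin n)) : ℕ :=
  Multiset.card τ.cycleType + (Finset.univ.filter fun i => τ i = i).card

/-- Color sum of a colored permutation. -/
def csum {r n : ℕ} (z : Fin n → Fin r) : ℕ := ∑ i, (z i : ℕ)

/-- #{i : z_i = 0 and τ(i) > i}. -/
def excA {r n : ℕ} (z : Fin n → Fin r) (τ : Equiv.Perm (Fin n)) : ℕ :=
  (Finset.univ.filter fun i => (z i : ℕ) = 0 ∧ i < τ i).card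

/-- Excedance number with respect to the absolute order. -/
def excAbs {r n : ℕ} (z : Fin n → Fin r) (τ : Equiv.Perm (Fin n)) : ℕ :=
  exc τ + csum z

/-- Excedance number with respect to the color order. -/
def excClr {r n : ℕ} (z : Fin n → Fin r) (τ : Equiv.Perm (Fin n)) : ℕ :=
  r * excA z τ + csum z

/-- The sign of a permutation determines the parity of its number of cycles. -/
theorem neg_one_pow_cyc {R : Type*} [CommRing R] {n : ℕ} (τ : Equiv.Perm (Fin n)) :
    (-1 : R) ^ cyc τ = (-1) ^ n * ((Equiv.Perm.sign τ : ℤ) : R) := by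
  have hfix : τ.support.card + (Finset.univ.filter fun i => τ i = i).card = n := by
    have h := Finset.card_filter_add_card_filter_not
      (s := (Finset.univ : Finset (Fin n))) (fun i => τ i = i)
    rw [Finset.card_univ, Fintype.card_fin] at h
    rw [add_comm]
    exact h
  have hn : (-1 : R) ^ n =
      (-1) ^ τ.support.card * (-1) ^ (Finset.univ.filter fun i => τ i = i).card := by
    rw [← pow_add, hfix]
  have hsq : (-1 : R) ^ τ.support.card * (-1) ^ τ.support.card = 1 := by
    rw [← mul_pow]; simp
  rw [Equiv.Perm.sign_of_cycleType, Equiv.Perm.sum_cycleType, hn, cyc, pow_add]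
  push_cast
  rw [pow_add]
  linear_combination (-(-1 : R) ^ Multiset.card τ.cycleType *
    (-1) ^ (Finset.univ.filter fun i => τ i = i).card) * hsq

/-- The determinant of the matrix with entries `q` strictly below the diagonal and `1` elsewhere. -/
theorem det_ite_lt {R : Type*} [CommRing R] (q : R) (n : ℕ) :
    (Matrix.of fun i j : Fin (n + 1) => if j < i then q else 1).det = (1 - q) ^ n := by
  rw [Matrix.det_eq_of_forall_col_eq_smul_add_pred
    (B := Matrix.of fun i j : Fin (n + 1) =>
      if j = 0 then (if 0 < i then q else 1) else if i = j then 1 - q else 0) (fun _ => 1)]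
  · rw [Matrix.det_of_isLowerTriangular, Fin.prod_univ_succ]
    · simp [Fin.succ_ne_zero]
    · intro i j hij
      have hij : i < j := hij
      have hj : j ≠ 0 := (i.zero_le.trans_lt hij).ne'
      simp [hj, hij.ne]
  · intro i
    simp
  · intro i j
    simp only [Matrix.of_apply, Fin.succ_ne_zero, if_false, one_mul]
    rcases lt_trichotomy i j.succ with h | h | h
    · have h' : ¬ j.castSucc < i := by simpa [Fin.lt_def, Nat.lt_succ_iff] using h
      simp [h.ne, h.not_gt, h']
    · simp [h]
    · have h' : j.castSucc < i := j.castSucc_lt_succ.trans h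
      simp [h.ne', h, h']

/-- The signed excedance generating function of the symmetric group. -/
theorem sum_sign_mul_pow_exc {R : Type*} [CommRing R] (q : R) (n : ℕ) :
    ∑ τ : Equiv.Perm (Fin (n + 1)), ((Equiv.Perm.sign τ : ℤ) : R) * q ^ exc τ = (1 - q) ^ n := by
  rw [← det_ite_lt, Matrix.det_apply']
  refine Finset.sum_congr rfl fun τ _ => ?_
  simp [exc, Finset.prod_ite]

/-- The color sum generating function. -/
theorem sum_pow_csum {R : Type*} [CommSemiring R] (q : R) (r n : ℕ) :
    ∑ z : Fin n → Fin r, q ^ csum z = (∑ i ∈ Finset.range r, q ^ i) ^ n := by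
  simp only [csum, ← Finset.prod_pow_eq_pow_sum]
  rw [← Fin.sum_univ_eq_sum_range, Fintype.sum_pow]

theorem stmt0 (r n : ℕ) (hr : 0 < r) (hn : 0 < n) :
    ∑ σ : (Fin n → Fin r) × Equiv.Perm (Fin n),
      (X : Polynomial ℤ) ^ excAbs σ.1 σ.2 * (-1) ^ cyc σ.2 =
    -((X : Polynomial ℤ) ^ r - 1) ^ (n - 1) * ∑ i ∈ Finset.range r, (X : Polynomial ℤ) ^ i := by
  obtain ⟨n, rfl⟩ := Nat.exists_eq_add_one.mpr hn
  rw [Fintype.sum_prod_type]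
  calc
    _ = ∑ z : Fin (n + 1) → Fin r, ∑ τ : Equiv.Perm (Fin (n + 1)), (X : ℤ[X]) ^ csum z *
          ((-1) ^ (n + 1) * (((Equiv.Perm.sign τ : ℤ) : ℤ[X]) * X ^ exc τ)) := by
      refine Finset.sum_congr rfl fun z _ => Finset.sum_congr rfl fun τ _ => ?_
      rw [neg_one_pow_cyc, excAbs, pow_add]
      ring
    _ = (∑ i ∈ Finset.range r, (X : ℤ[X]) ^ i) ^ (n + 1) *
          ((-1) ^ (n + 1) * (1 - X) ^ n) := by
      rw [← Finset.sum_mul_sum, ← Finset.mul_sum, sum_pow_csum, sum_sign_mul_pow_exc]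
    _ = _ := by
      rw [Nat.add_sub_cancel, ← geom_sum_mul, mul_pow, ← neg_sub (X : ℤ[X]) 1, neg_pow (X - 1) n]
      have hsq : (-1 : ℤ[X]) ^ n * (-1) ^ n = 1 := by
        rw [← mul_pow]; simp
      linear_combination (-(∑ i ∈ Finset.range r, (X : ℤ[X]) ^ i) ^ (n + 1) * (X - 1) ^ n) * hsq
end

section
/- For all positive integers r and n, in ℤ[q] one has ∑_{σ ∈ D_{r,n}} q^{exc^Clr(σ)} (−1)^{cyc(σ)} = −q · [r]_q^n · [n−1]_q, where the sum is over all derangements in G_{r,n}. -/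
open Finset Polynomial

/-- Adding a constant `t` to all entries of a matrix changes its determinant affinely in `t`. -/
theorem exists_det_add_const {ι R : Type*} [Fintype ι] [DecidableEq ι] [CommRing R]
    (M : Matrix ι ι R) (k : ι) :
    ∃ c : R, ∀ t : R, (Matrix.of fun i j => M i j + t).det = M.det + t * c := by
  set N : Matrix ι ι R := Matrix.of fun i j => M i j - M k j with hN
  have key : ∀ t : R, (Matrix.of fun i j => M i j + t).det =
      (N.updateRow k (M k)).det + t * (N.updateRow k 1).det := by
    intro t
    rw [← Matrix.det_updateRow_smul, ← Matrix.det_updateRow_add]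
    refine Matrix.det_eq_of_forall_row_eq_smul_add_const (fun i => if i = k then 0 else 1) k
      (by simp) fun i j => ?_
    by_cases h : i = k
    · subst h
      simp
    · simp only [Matrix.of_apply, Matrix.updateRow_ne h, Matrix.updateRow_self, hN, h, if_false,
        Pi.add_apply, Pi.smul_apply, Pi.one_apply, smul_eq_mul]
      ring
  refine ⟨(N.updateRow k 1).det, fun t => ?_⟩
  have h0 := key 0
  simp only [add_zero, zero_mul] at h0
  rw [key t, ← h0]
  rfl

/-- The matrix with zero diagonal, entries `a` below the diagonal and entries `b` above it. -/
def zeroDiagMatrix {R : Type*} [CommRing R] (n : ℕ) (a b : R) : Matrix (Fin n) (Fin n) R :=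
  Matrix.of fun i j => if i = j then 0 else if j < i then a else b

theorem sub_mul_det_zeroDiagMatrix {R : Type*} [CommRing R] (n : ℕ) [NeZero n] (a b : R) :
    (a - b) * (zeroDiagMatrix n a b).det = a * (-b) ^ n - b * (-a) ^ n := by
  obtain ⟨c, hc⟩ := exists_det_add_const (zeroDiagMatrix n a b) 0
  have ha := hc (-a)
  have hb := hc (-b)
  rw [Matrix.det_of_isUpperTriangular] at ha
  · rw [Matrix.det_of_isLowerTriangular] at hb
    · simp only [zeroDiagMatrix, Matrix.of_apply, if_true, zero_add, prod_const, card_univ,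
        Fintype.card_fin] at ha hb
      rw [ha, hb]
      unfold zeroDiagMatrix
      ring
    · intro i j hij
      have h : i < j := hij
      simp [zeroDiagMatrix, h.ne, h.not_gt]
  · intro i j hij
    have h : j < i := hij
    simp [zeroDiagMatrix, h.ne', h]

theorem neg_one_pow_cyc_of_derangement {n : ℕ} (τ : Equiv.Perm (Fin n)) (h : ∀ i, τ i ≠ i) :
    (-1 : ℤ[X]) ^ cyc τ = (-1) ^ n * ((Equiv.Perm.sign τ : ℤ) : ℤ[X]) := by
  have hs : τ.support = Finset.univ := by
    ext i
    simp [h i]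
  have hc : cyc τ = Multiset.card τ.cycleType := by
    simp [cyc, h]
  rw [Equiv.Perm.sign_of_cycleType, Equiv.Perm.sum_cycleType, hs, hc]
  simp only [card_univ, Fintype.card_fin]
  push_cast
  rw [pow_add, ← mul_assoc, ← mul_pow]
  simp

theorem sum_pow_excClr {r n : ℕ} (hr : 0 < r) (τ : Equiv.Perm (Fin n)) :
    ∑ z : Fin n → Fin r, (X : ℤ[X]) ^ excClr z τ =
      (∑ i ∈ Finset.range r, (X : ℤ[X]) ^ i) ^ n * ∏ i, if i < τ i then X else 1 := by
  have h1 : ∀ z : Fin n → Fin r, (X : ℤ[X]) ^ excClr z τ =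
      ∏ i, (X : ℤ[X]) ^ ((if (z i : ℕ) = 0 ∧ i < τ i then r else 0) + (z i : ℕ)) := by
    intro z
    rw [prod_pow_eq_pow_sum, sum_add_distrib, ← sum_filter, sum_const, excClr, excA, csum,
      smul_eq_mul, mul_comm]
  have h2 : ∀ i : Fin n,
      ∑ c : Fin r, (X : ℤ[X]) ^ ((if (c : ℕ) = 0 ∧ i < τ i then r else 0) + (c : ℕ)) =
        (∑ i ∈ Finset.range r, (X : ℤ[X]) ^ i) * if i < τ i then X else 1 := by
    intro i
    obtain ⟨s, rfl⟩ : ∃ s, r = s + 1 := ⟨r - 1, by omega⟩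
    by_cases h : i < τ i
    · rw [Fin.sum_univ_succ, Finset.sum_range_succ, Finset.sum_range]
      simp only [h, if_true, Fin.val_zero, Fin.val_succ, Nat.succ_ne_zero, false_and, true_and,
        if_false, zero_add, add_zero, add_mul, Finset.sum_mul, pow_succ]
      ring
    · simp [h, Finset.sum_range]
  simp_rw [h1]
  rw [← Fintype.piFinset_univ, Finset.sum_prod_piFinset Finset.univ
    (fun i (c : Fin r) => (X : ℤ[X]) ^ ((if (c : ℕ) = 0 ∧ i < τ i then r else 0) + (c : ℕ)))]
  simp_rw [h2]
  rw [prod_mul_distrib, prod_const, card_univ, Fintype.card_fin]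

theorem det_zeroDiagMatrix_eq_sum_derangements {R : Type*} [CommRing R] (n : ℕ) (a b : R) :
    (zeroDiagMatrix n a b).det =
      ∑ τ : Equiv.Perm (Fin n) with ∀ i, τ i ≠ i,
        ((Equiv.Perm.sign τ : ℤ) : R) * ∏ i, if i < τ i then a else b := by
  rw [Matrix.det_apply', sum_filter]
  refine sum_congr rfl fun τ _ => ?_
  split_ifs with h
  · simp [zeroDiagMatrix, h]
  · push Not at h
    obtain ⟨i, hi⟩ := h
    rw [prod_eq_zero (mem_univ i) (by simp [zeroDiagMatrix, hi]), mul_zero]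

theorem neg_one_pow_mul_det_zeroDiagMatrix_X_one (n : ℕ) (hn : 0 < n) :
    (-1) ^ n * (zeroDiagMatrix n (X : ℤ[X]) 1).det =
      -X * ∑ i ∈ Finset.range (n - 1), (X : ℤ[X]) ^ i := by
  have : NeZero n := ⟨hn.ne'⟩
  have hX : (X - 1 : ℤ[X]) ≠ 0 := X_sub_C_ne_zero 1
  apply mul_left_cancel₀ hX
  have h := sub_mul_det_zeroDiagMatrix n (X : ℤ[X]) 1
  have hg := mul_geom_sum (X : ℤ[X]) (n - 1)
  have hp : (X : ℤ[X]) ^ n = X * X ^ (n - 1) := by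
    rw [← pow_succ', Nat.sub_add_cancel hn]
  have hm : ((-1 : ℤ[X]) ^ n) * (-1) ^ n = 1 := by
    rw [← mul_pow]
    simp
  rw [neg_pow (X : ℤ[X]), hp] at h
  linear_combination (-1) ^ n * h + X * hg + (X - X * X ^ (n - 1)) * hm

theorem stmt5 (r n : ℕ) (hr : 0 < r) (hn : 0 < n) :
    ∑ σ ∈ Finset.univ.filter
        (fun σ : (Fin n → Fin r) × Equiv.Perm (Fin n) => ∀ i, σ.2 i ≠ i),
      (X : Polynomial ℤ) ^ excClr σ.1 σ.2 * (-1) ^ cyc σ.2 =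
    -(X : Polynomial ℤ) * (∑ i ∈ Finset.range r, (X : Polynomial ℤ) ^ i) ^ n *
      ∑ i ∈ Finset.range (n - 1), (X : Polynomial ℤ) ^ i := by
  rw [mul_right_comm, ← neg_one_pow_mul_det_zeroDiagMatrix_X_one n hn,
    det_zeroDiagMatrix_eq_sum_derangements, mul_sum, sum_mul, sum_filter,
    Fintype.sum_prod_type_right, sum_filter]
  refine sum_congr rfl fun τ _ => ?_
  by_cases h : ∀ i, τ i ≠ i
  · simp only [if_pos h]
    rw [← sum_mul, sum_pow_excClr hr, neg_one_pow_cyc_of_derangement τ h]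
    ring
  · simp only [if_neg h, sum_const_zero]
end

section
/- For every positive integer r and every integer n ≥ 2, in ℤ[q] one has ∑_{σ ∈ D_{r,n}} q^{exc^Abs(σ)} (−1)^{cyc(σ)} = [r]_q · ( ∑_{σ ∈ D_{r,n−1}} q^{exc^Abs(σ)} (−1)^{cyc(σ)} − q^{n−1} [r]_q^{n−1} ), where the sums are over derangements. -/
open Finset Polynomial

/-- The matrix with `X` above the diagonal, `1` below it, and diagonal `c, 0, …, 0`. -/
noncomputable def excMatrix (n : ℕ) (c : ℤ[X]) : Matrix (Fin (n + 1)) (Fin (n + 1)) ℤ[X] :=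
  fun i j => if i < j then X else if j < i then 1 else if i = 0 then c else 0

theorem excMatrix_det_succ (n : ℕ) (c : ℤ[X]) :
    (excMatrix (n + 1) c).det =
      (c - 1) * (excMatrix n 0).det - X * (excMatrix n 1).det := by
  have h01 : (0 : Fin (n + 2)) ≠ 1 := by simp
  rw [← Matrix.det_updateRow_add_smul_self (excMatrix (n + 1) c) h01 (-1),
    Matrix.det_succ_row_zero, Fin.sum_univ_succ, Fin.sum_univ_succ, Finset.sum_eq_zero]
  · have hA : ((excMatrix (n + 1) c).updateRow 0 (excMatrix (n + 1) c 0 +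
        (-1 : ℤ[X]) • excMatrix (n + 1) c 1)).submatrix Fin.succ (Fin.succAbove 0)
          = excMatrix n 0 := by
      ext1 i j
      simp [excMatrix, Matrix.updateRow_apply]
    have hB : ((excMatrix (n + 1) c).updateRow 0 (excMatrix (n + 1) c 0 +
        (-1 : ℤ[X]) • excMatrix (n + 1) c 1)).submatrix Fin.succ (Fin.succAbove (Fin.succ 0))
          = excMatrix n 1 := by
      ext1 i j
      refine Fin.cases ?_ (fun j => ?_) j
      · simp only [excMatrix, Matrix.updateRow_apply, Matrix.submatrix_apply]
        by_cases hi : i = 0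
        · simp [hi]
        · simp [hi, Fin.pos_iff_ne_zero]
      · have hj : (Fin.succ (0 : Fin (n + 1))).succAbove j.succ = j.succ.succ := by
          simp
        simp only [Matrix.submatrix_apply, hj, Matrix.updateRow_apply, excMatrix,
          Fin.succ_lt_succ_iff]
        by_cases h1 : i < j.succ
        · simp [h1]
        · by_cases h2 : j.succ < i
          · simp [h1, h2]
          · have : i = j.succ := le_antisymm (not_lt.1 h2) (not_lt.1 h1)
            simp [this]
    rw [hA, hB]
    simp [excMatrix]
    ring
  · intro j _
    have h0 : (0 : Fin (n + 2)) < j.succ.succ := Fin.succ_pos _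
    have h1 : (1 : Fin (n + 2)) < j.succ.succ := by
      rw [← Fin.succ_zero_eq_one, Fin.succ_lt_succ_iff]; exact Fin.succ_pos _
    simp [excMatrix, h0, h1]

theorem excMatrix_one_det (n : ℕ) : (excMatrix n 1).det = (-X) ^ n := by
  induction n with
  | zero => simp [excMatrix]
  | succ n ih => rw [excMatrix_det_succ, ih]; ring

/-- The sum of `X ^ exc τ * (-1) ^ cyc τ` over the derangements `τ` of `Fin n`. -/
noncomputable def derangementSum (n : ℕ) : ℤ[X] :=
  ∑ τ : Equiv.Perm (Fin n) with ∀ i, τ i ≠ i, X ^ exc τ * (-1) ^ cyc τ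

theorem sign_eq_neg_one_pow_cyc {n : ℕ} {τ : Equiv.Perm (Fin n)} (h : ∀ i, τ i ≠ i) :
    (Equiv.Perm.sign τ : ℤ) = (-1) ^ (n + cyc τ) := by
  have hs : τ.support = univ := by ext i; simp [h]
  rw [Equiv.Perm.sign_of_cycleType, Equiv.Perm.sum_cycleType, hs]
  simp [cyc, h]

theorem derangementSum_eq_det (n : ℕ) :
    derangementSum (n + 1) = (-1) ^ (n + 1) * (excMatrix n 0).det := by
  rw [← Matrix.det_transpose, Matrix.det_apply', derangementSum, Finset.sum_filter,
    Finset.mul_sum]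
  refine Finset.sum_congr rfl fun τ _ => ?_
  split_ifs with h
  · have hp : ∏ i, (excMatrix n 0).transpose (τ i) i = X ^ exc τ := by
      rw [exc, ← Finset.prod_const, Finset.prod_filter]
      refine Finset.prod_congr rfl fun i _ => ?_
      rcases lt_or_gt_of_ne (h i) with hi | hi
      · simp [excMatrix, hi, hi.not_gt]
      · simp [excMatrix, hi]
    rw [hp, sign_eq_neg_one_pow_cyc h]
    push_cast
    have h1 : ((-1 : ℤ[X]) ^ (n + 1)) * (-1) ^ (n + 1) = 1 := by
      rw [← pow_add, Even.neg_one_pow ⟨n + 1, rfl⟩]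
    rw [pow_add _ (n + 1)]
    linear_combination (-(X ^ exc τ * (-1) ^ cyc τ)) * h1
  · push Not at h
    obtain ⟨i, hi⟩ := h
    rw [Finset.prod_eq_zero (Finset.mem_univ i), mul_zero, mul_zero]
    simp [excMatrix, hi]

theorem derangementSum_succ (n : ℕ) :
    derangementSum (n + 2) = derangementSum (n + 1) - X ^ (n + 1) := by
  rw [derangementSum_eq_det, derangementSum_eq_det, excMatrix_det_succ, excMatrix_one_det,
    neg_pow (X : ℤ[X]) n]
  have h : ((-1 : ℤ[X]) ^ n) * (-1) ^ n = 1 := by rw [← pow_add, Even.neg_one_pow ⟨n, rfl⟩]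
  linear_combination (-X ^ (n + 1)) * h

theorem sum_X_pow_csum (r n : ℕ) :
    ∑ z : Fin n → Fin r, (X : ℤ[X]) ^ csum z = (∑ i ∈ Finset.range r, X ^ i) ^ n := by
  rw [Finset.sum_range, Fintype.sum_pow]
  simp [csum, Finset.prod_pow_eq_pow_sum]

theorem colored_derangement_sum (r n : ℕ) :
    ∑ σ ∈ Finset.univ.filter
        (fun σ : (Fin n → Fin r) × Equiv.Perm (Fin n) => ∀ i, σ.2 i ≠ i),
      (X : Polynomial ℤ) ^ excAbs σ.1 σ.2 * (-1) ^ cyc σ.2 =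
    (∑ i ∈ Finset.range r, X ^ i) ^ n * derangementSum n := by
  rw [← sum_X_pow_csum, derangementSum, Finset.sum_mul_sum, ← Finset.sum_product']
  refine Finset.sum_congr (by ext; simp) fun σ _ => ?_
  rw [excAbs, pow_add]
  ring

theorem stmt6 (r n : ℕ) (hr : 0 < r) (hn : 2 ≤ n) :
    ∑ σ ∈ Finset.univ.filter
        (fun σ : (Fin n → Fin r) × Equiv.Perm (Fin n) => ∀ i, σ.2 i ≠ i),
      (X : Polynomial ℤ) ^ excAbs σ.1 σ.2 * (-1) ^ cyc σ.2 =
    (∑ i ∈ Finset.range r, (X : Polynomial ℤ) ^ i) *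
      ((∑ σ ∈ Finset.univ.filter
          (fun σ : (Fin (n - 1) → Fin r) × Equiv.Perm (Fin (n - 1)) => ∀ i, σ.2 i ≠ i),
        (X : Polynomial ℤ) ^ excAbs σ.1 σ.2 * (-1) ^ cyc σ.2) -
       (X : Polynomial ℤ) ^ (n - 1) * (∑ i ∈ Finset.range r, (X : Polynomial ℤ) ^ i) ^ (n - 1)) := by
  obtain ⟨m, rfl⟩ := Nat.exists_eq_add_of_le' hn
  rw [colored_derangement_sum, colored_derangement_sum, show m + 2 - 1 = m + 1 from rfl,
    derangementSum_succ]
  ring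
end

section
/- Let σ = (z, τ) ∈ G_{r,n} act on the colored alphabet Σ = {(i, j) : i ∈ {1,…,n}, j ∈ {0,…,r−1}} by σ(i, j) = (τ(i), (j + z_i) mod r), and order Σ by the color order: (i, j) < (k, l) iff j > l, or j = l and i < k. Then the number of elements x ∈ Σ with σ(x) > x equals r·exc_A(σ) + csum(σ), i.e., equals exc^Clr(σ). -/
open Finset Polynomial

theorem Fin.add_lt_left_iff_rev_lt {r : ℕ} (j c : Fin r) : j + c < j ↔ j.rev < c := by
  have hj := j.isLt
  have hc := c.isLt
  rw [Fin.lt_def, Fin.lt_def, Fin.val_add_eq_ite, Fin.val_rev]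
  split_ifs <;> omega

theorem Fin.card_filter_add_lt_left {r : ℕ} (c : Fin r) :
    (Finset.univ.filter fun j : Fin r => j + c < j).card = c := by
  rw [← Fin.card_Iio c]
  refine Finset.card_equiv Fin.revPerm fun j => ?_
  simp [Fin.add_lt_left_iff_rev_lt]

theorem Fin.add_eq_left_iff_val_eq_zero {r : ℕ} (j c : Fin r) :
    j + c = j ↔ (c : ℕ) = 0 := by
  have hj := j.isLt
  have hc := c.isLt
  rw [Fin.ext_iff, Fin.val_add_eq_ite]
  split_ifs <;> omega

theorem Fin.card_filter_add_lt_left_or {r : ℕ} (c : Fin r) (P : Prop) [Decidable P] :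
    (Finset.univ.filter fun j : Fin r => j + c < j ∨ (j + c = j ∧ P)).card =
      r * (if (c : ℕ) = 0 ∧ P then 1 else 0) + c := by
  simp only [Fin.add_eq_left_iff_val_eq_zero]
  split_ifs with h
  · simp [h]
  · simp only [h, or_false]
    simp [Fin.card_filter_add_lt_left]

theorem stmt11 (r n : ℕ) (hr : 0 < r) (hn : 0 < n)
    (z : Fin n → Fin r) (τ : Equiv.Perm (Fin n)) :
    (Finset.univ.filter fun p : Fin n × Fin r =>
        p.2 + z p.1 < p.2 ∨ (p.2 + z p.1 = p.2 ∧ p.1 < τ p.1)).card =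
    r * excA z τ + csum z := by
  rw [excA, csum, Finset.card_filter, Finset.card_filter, Fintype.sum_prod_type, Finset.mul_sum,
    ← Finset.sum_add_distrib]
  refine Finset.sum_congr rfl fun i _ => ?_
  rw [← Fin.card_filter_add_lt_left_or, Finset.card_filter]
end
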